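/- arXiv:2312.02426 — 2 statements merged into one kernel-verified Lean document; each statement's English description precedes it below -/
import Mathlib

section
/- Let A be a finite nonempty set of positive integers, let S ∈ {0,1}^L be a seed, and let b be a positive integer with b ∉ A. Then w^{A∪{b},S}(n) = w^{A,S}(n) for all n ≥ 0 if and only if for every n ≥ 0, w^{A,S}(n) = 0 implies w^{A,S}(n − b) = 1. -/
open Classical in
/-- The winning sequence on ℕ, where `seed` gives values at negative positions. -/
noncomputable def subW (A : Set ℕ) (seed : ℤ → ℕ) : ℕ → ℕ := fun n =>
  Nat.strongRecOn n (fun n ih =>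
    if ∃ x ∈ A, (if h : 0 < x ∧ x ≤ n then ih (n - x) (by omega)
                 else seed ((n : ℤ) - (x : ℤ))) = 0
    then 1 else 0)

/-- The winning sequence `w^{A,seed} : ℤ → ℕ`. -/
noncomputable def W (A : Set ℕ) (seed : ℤ → ℕ) : ℤ → ℕ := fun n =>
  if 0 ≤ n then subW A seed n.toNat else seed n

/-- The trivial seed (all ones), giving the unseeded sequence `w^A`. -/
def one : ℤ → ℕ := fun _ => 1

/-- The seed function determined by a string `S ∈ {0,1}^L`: `w(-i) = S_i` for `1 ≤ i ≤ L`,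
and `w(n) = 1` for `n < -L`. -/
def seedExt (L : ℕ) (S : ℕ → Bool) : ℤ → ℕ := fun j =>
  if -(L : ℤ) ≤ j ∧ j < 0 then (if S ((-j).toNat - 1) then 1 else 0) else 1

/-- `w` is eventually periodic over `p`. -/
def PeriodicOver (w : ℤ → ℕ) (p : ℕ) : Prop :=
  ∃ N : ℕ, ∀ n : ℤ, (N : ℤ) ≤ n → w n = w (n + p)

/-- The (eventual) period: the least `p ≥ 1` over which `w` is eventually periodic. -/
noncomputable def per (w : ℤ → ℕ) : ℕ := sInf {p : ℕ | 0 < p ∧ PeriodicOver w p}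

/-- The preperiod: the least `N` that works for `p = per w`. -/
noncomputable def preper (w : ℤ → ℕ) : ℕ :=
  sInf {N : ℕ | ∀ n : ℤ, (N : ℤ) ≤ n → w n = w (n + per w)}

theorem subW_eq (A : Set ℕ) (seed : ℤ → ℕ) (n : ℕ) [Decidable (∃ x ∈ A,
    (if 0 < x ∧ x ≤ n then subW A seed (n - x) else seed ((n : ℤ) - (x : ℤ))) = 0)] :
    subW A seed n = if ∃ x ∈ A, (if 0 < x ∧ x ≤ n then subW A seed (n - x)
      else seed ((n : ℤ) - (x : ℤ))) = 0 then 1 else 0 := by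
  unfold subW
  rw [Nat.strongRecOn, WellFounded.fix_eq]
  simp only [dite_eq_ite]
  congr

/-- The defining recursion of the winning sequence at nonnegative positions. -/
theorem W_eq_one_iff {A : Set ℕ} (hpos : ∀ x ∈ A, 0 < x) (seed : ℤ → ℕ) {n : ℤ} (hn : 0 ≤ n) :
    W A seed n = 1 ↔ ∃ x ∈ A, W A seed (n - x) = 0 := by
  classical
  lift n to ℕ using hn
  have key : ∀ x ∈ A, (if 0 < x ∧ x ≤ n then subW A seed (n - x)
      else seed ((n : ℤ) - (x : ℤ))) = W A seed ((n : ℤ) - x) := by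
    intro x hx
    have := hpos x hx
    by_cases h : x ≤ n
    · have h' : ((n : ℤ) - x).toNat = n - x := by omega
      simp [W, h, this, h']
    · simp [W, h]
  have hW : W A seed n = subW A seed n := by simp [W]
  rw [hW, subW_eq]
  simp only [ite_eq_left_iff, zero_ne_one, imp_false, not_not]
  exact exists_congr fun x => and_congr_right fun hx => by rw [key x hx]

theorem W_eq_zero_or_one (A : Set ℕ) (L : ℕ) (S : ℕ → Bool) (n : ℤ) :
    W A (seedExt L S) n = 0 ∨ W A (seedExt L S) n = 1 := by
  classical
  unfold W
  split_ifs
  · rw [subW_eq]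
    split_ifs <;> simp
  · unfold seedExt
    split_ifs <;> simp

theorem W_of_neg (A : Set ℕ) (seed : ℤ → ℕ) {n : ℤ} (hn : n < 0) : W A seed n = seed n := by
  simp [W, hn]

/-- `b ∉ A` is an extension of `(A, S)` iff whenever `w^{A,S}(n) = 0`
for `n ≥ 0` we have `w^{A,S}(n - b) = 1`. -/
theorem stmt_4 (A : Finset ℕ) (hA : A.Nonempty) (hpos : ∀ x ∈ A, 0 < x)
    (L : ℕ) (S : ℕ → Bool) (b : ℕ) (hb : 0 < b) (hbA : b ∉ A) :
    (∀ n : ℤ, 0 ≤ n →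
        W ↑(insert b A) (seedExt L S) n = W ↑A (seedExt L S) n) ↔
    (∀ n : ℤ, 0 ≤ n →
        W ↑A (seedExt L S) n = 0 → W ↑A (seedExt L S) (n - b) = 1) := by
  have hposA : ∀ x ∈ (A : Set ℕ), 0 < x := by simpa using hpos
  have hposB : ∀ x ∈ (↑(insert b A) : Set ℕ), 0 < x := by
    intro x hx
    simp only [Finset.coe_insert, Set.mem_insert_iff] at hx
    rcases hx with rfl | hx
    · exact hb
    · exact hposA x hx
  have recB : ∀ n : ℤ, 0 ≤ n → (W ↑(insert b A) (seedExt L S) n = 1 ↔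
      W ↑(insert b A) (seedExt L S) (n - b) = 0 ∨
        ∃ x ∈ (A : Set ℕ), W ↑(insert b A) (seedExt L S) (n - x) = 0) := by
    intro n hn
    rw [W_eq_one_iff hposB _ hn]
    simp
  have recA : ∀ n : ℤ, 0 ≤ n → (W ↑A (seedExt L S) n = 1 ↔
      ∃ x ∈ (A : Set ℕ), W ↑A (seedExt L S) (n - x) = 0) :=
    fun n hn => W_eq_one_iff hposA _ hn
  have valA := W_eq_zero_or_one (A : Set ℕ) L S
  have valB := W_eq_zero_or_one (↑(insert b A) : Set ℕ) L S
  have negEq : ∀ n : ℤ, n < 0 →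
      W ↑(insert b A) (seedExt L S) n = W ↑A (seedExt L S) n :=
    fun n hn => by rw [W_of_neg _ _ hn, W_of_neg _ _ hn]
  constructor
  · intro h n hn h0
    refine (valA (n - b)).resolve_left fun hz => ?_
    have hall : W ↑(insert b A) (seedExt L S) (n - b) = W ↑A (seedExt L S) (n - b) :=
      (lt_or_ge (n - b : ℤ) 0).elim (negEq _) (h _)
    have h1 := (recB n hn).2 (Or.inl (hall.trans hz))
    rw [h n hn, h0] at h1
    exact zero_ne_one h1
  · intro h n hn
    lift n to ℕ using hn
    induction n using Nat.strong_induction_on with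
    | _ n ih =>
    have prev : ∀ x : ℕ, 0 < x →
        W ↑(insert b A) (seedExt L S) (n - x) = W ↑A (seedExt L S) (n - x) := by
      intro x hx
      rcases lt_or_ge (n - x : ℤ) 0 with hlt | hge
      · exact negEq _ hlt
      · have := ih (n - x) (by omega)
        rwa [Nat.cast_sub (by omega)] at this
    have hiff : W ↑(insert b A) (seedExt L S) n = 1 ↔ W ↑A (seedExt L S) n = 1 := by
      have hex : (∃ x ∈ (A : Set ℕ), W ↑(insert b A) (seedExt L S) (n - x) = 0) ↔
          ∃ x ∈ (A : Set ℕ), W ↑A (seedExt L S) (n - x) = 0 :=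
        exists_congr fun x => and_congr_right fun hx => by rw [prev x (hposA x hx)]
      rw [recB n (by positivity), prev b hb, hex, ← recA n (by positivity)]
      refine or_iff_right_of_imp fun hz => (valA n).resolve_left fun h0 => ?_
      have := h n (by positivity) h0
      omega
    have := valA n
    have := valB n
    omega
end

section
/- Let a = 2^k·c with c odd. Then the set of attainable periods of the {a}-subtraction game over all seeds is {per({a},S) : S ∈ {0,1}^a} = {2^{k+1}·d : d is a positive divisor of c}. -/
open Classical in
theorem W_of_nonneg {A : Set ℕ} (hA : ∀ x ∈ A, 0 < x) (seed : ℤ → ℕ) {n : ℤ} (hn : 0 ≤ n) :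
    W A seed n = if ∃ x ∈ A, W A seed (n - x) = 0 then 1 else 0 := by
  lift n to ℕ using hn
  have hstep : ∀ x ∈ A, (if _ : 0 < x ∧ x ≤ n then subW A seed (n - x)
      else seed ((n : ℤ) - (x : ℤ))) = W A seed ((n : ℤ) - x) := by
    intro x hx
    have hpos := hA x hx
    unfold W
    by_cases h : x ≤ n
    · rw [dif_pos ⟨hpos, h⟩, if_pos (by omega)]
      congr 1
      omega
    · rw [dif_neg (by omega), if_neg (by omega)]
  have hW : W A seed (n : ℤ) = subW A seed n := by simp [W]
  have hrec : subW A seed n = if ∃ x ∈ A, (if _ : 0 < x ∧ x ≤ n then subW A seed (n - x)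
      else seed ((n : ℤ) - (x : ℤ))) = 0 then 1 else 0 := by
    conv_lhs => rw [subW, Nat.strongRecOn_eq]
    rfl
  rw [hW, hrec]
  refine if_congr (exists_congr fun x => and_congr_right fun hx => ?_) rfl rfl
  rw [hstep x hx]

theorem W_singleton_of_nonneg {a : ℕ} (ha : 0 < a) (seed : ℤ → ℕ) {n : ℤ} (hn : 0 ≤ n) :
    W {a} seed n = if W {a} seed (n - a) = 0 then 1 else 0 := by
  rw [W_of_nonneg (by simpa using ha) seed hn]
  simp

theorem W_singleton_le_one {a : ℕ} (ha : 0 < a) (S : ℕ → Bool) (n : ℤ) :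
    W {a} (seedExt a S) n ≤ 1 := by
  by_cases hn : 0 ≤ n
  · rw [W_singleton_of_nonneg ha _ hn]
    split_ifs <;> omega
  · simp only [W, if_neg hn, seedExt]
    split_ifs <;> omega

theorem W_singleton_add {a : ℕ} (ha : 0 < a) (S : ℕ → Bool) {n : ℤ} (hn : 0 ≤ n) :
    W {a} (seedExt a S) (n + a) = 1 - W {a} (seedExt a S) n := by
  have hle := W_singleton_le_one ha S n
  rw [W_singleton_of_nonneg ha _ (by omega : 0 ≤ n + (a : ℤ)), add_sub_cancel_right]
  split_ifs <;> omega

theorem periodicOver_two_mul {a : ℕ} (ha : 0 < a) (S : ℕ → Bool) :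
    PeriodicOver (W {a} (seedExt a S)) (2 * a) := by
  refine ⟨0, fun n hn => ?_⟩
  have hn' : 0 ≤ n := by simpa using hn
  have hle := W_singleton_le_one ha S n
  have h : n + ((2 * a : ℕ) : ℤ) = n + a + a := by push_cast; ring
  rw [h, W_singleton_add ha S (by omega), W_singleton_add ha S hn']
  omega

theorem not_periodicOver_self {a : ℕ} (ha : 0 < a) (S : ℕ → Bool) :
    ¬ PeriodicOver (W {a} (seedExt a S)) a := by
  rintro ⟨N, hN⟩
  have h := hN N le_rfl
  have hadd := W_singleton_add ha S (Int.natCast_nonneg N)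
  omega

theorem add_mul_eq_of_le {w : ℤ → ℕ} {p N : ℕ} (h : ∀ n : ℤ, (N : ℤ) ≤ n → w n = w (n + p))
    (m : ℕ) {n : ℤ} (hn : (N : ℤ) ≤ n) : w (n + p * m) = w n := by
  induction m with
  | zero => simp
  | succ m ih =>
    have hnn : (0 : ℤ) ≤ p * m := by positivity
    rw [← ih, h _ (by omega : (N : ℤ) ≤ n + p * m)]
    congr 1
    push_cast
    ring

theorem PeriodicOver.mul_right {w : ℤ → ℕ} {p : ℕ} (h : PeriodicOver w p) (m : ℕ) :
    PeriodicOver w (p * m) := by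
  obtain ⟨N, hN⟩ := h
  refine ⟨N, fun n hn => ?_⟩
  rw [← add_mul_eq_of_le hN m hn]
  push_cast
  rfl

theorem PeriodicOver.mod {w : ℤ → ℕ} {p q : ℕ} (hp : PeriodicOver w p) (hq : PeriodicOver w q) :
    PeriodicOver w (q % p) := by
  obtain ⟨N, hN⟩ := hp
  obtain ⟨M, hM⟩ := hq
  refine ⟨max N M, fun n hn => ?_⟩
  have hNn : (N : ℤ) ≤ n := by omega
  rw [hM n (by omega), ← add_mul_eq_of_le hN (q / p) (by omega : (N : ℤ) ≤ n + (q % p : ℕ))]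
  congr 1
  have := Nat.mod_add_div q p
  zify at this ⊢
  linarith

theorem per_pos_and_periodicOver {w : ℤ → ℕ} {q : ℕ} (hq : 0 < q) (h : PeriodicOver w q) :
    0 < per w ∧ PeriodicOver w (per w) :=
  Nat.sInf_mem (s := {p : ℕ | 0 < p ∧ PeriodicOver w p}) ⟨q, hq, h⟩

theorem per_dvd {w : ℤ → ℕ} {q : ℕ} (hq : 0 < q) (h : PeriodicOver w q) : per w ∣ q := by
  obtain ⟨hpos, hper⟩ := per_pos_and_periodicOver hq h
  by_contra hd
  have hle : per w ≤ q % per w :=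
    Nat.sInf_le ⟨Nat.pos_of_ne_zero fun h0 => hd (Nat.dvd_of_mod_eq_zero h0), hper.mod h⟩
  exact absurd (Nat.mod_lt q hpos) (by omega)

theorem exists_eq_two_pow_mul_of_dvd {k c p : ℕ} (h : p ∣ 2 ^ (k + 1) * c)
    (h' : ¬ p ∣ 2 ^ k * c) : ∃ d, d ∣ c ∧ p = 2 ^ (k + 1) * d := by
  obtain ⟨y, z, hy, hz, rfl⟩ := (Nat.dvd_mul).1 h
  obtain ⟨j, hj, rfl⟩ := (Nat.dvd_prime_pow Nat.prime_two).1 hy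
  obtain rfl | hlt := hj.eq_or_lt
  · exact ⟨z, hz, rfl⟩
  · exact absurd (mul_dvd_mul (pow_dvd_pow 2 (Nat.lt_succ_iff.1 hlt)) hz) h'

/-- The square wave with half-period `b`. -/
def squareWave (b : ℕ) (n : ℤ) : ℕ := if n % (2 * b) < b then 1 else 0

theorem squareWave_add_two_mul (b : ℕ) (n m : ℤ) :
    squareWave b (n + 2 * b * m) = squareWave b n := by
  simp [squareWave]

theorem squareWave_sub_self {b : ℕ} (hb : 0 < b) (n : ℤ) :
    squareWave b n = if squareWave b (n - b) = 0 then 1 else 0 := by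
  have h0 := Int.emod_nonneg n (by omega : (2 * b : ℤ) ≠ 0)
  have h1 := Int.emod_lt_of_pos n (by omega : (0 : ℤ) < 2 * b)
  have hn := Int.emod_add_mul_ediv n (2 * b)
  have hsub : (n - b) % (2 * b) =
      if n % (2 * b) < b then n % (2 * b) + b else n % (2 * b) - b := by
    split_ifs with h
    · rw [show n - (b : ℤ) = n % (2 * b) + b + 2 * b * (n / (2 * b) - 1) by linarith,
        Int.add_mul_emod_self_left, Int.emod_eq_of_lt (by omega) (by omega)]
    · rw [show n - (b : ℤ) = n % (2 * b) - b + 2 * b * (n / (2 * b)) by linarith,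
        Int.add_mul_emod_self_left, Int.emod_eq_of_lt (by omega) (by omega)]
  unfold squareWave
  rw [hsub]
  split_ifs <;> first | rfl | omega

theorem squareWave_sub_odd_mul {b e : ℕ} (hb : 0 < b) (he : Odd e) (n : ℤ) :
    squareWave b n = if squareWave b (n - (b * e : ℕ)) = 0 then 1 else 0 := by
  obtain ⟨m, rfl⟩ := he
  rw [squareWave_sub_self hb, ← squareWave_add_two_mul b (n - (b * (2 * m + 1) : ℕ)) m]
  congr 3
  push_cast
  ring

theorem W_eq_squareWave {b e : ℕ} (hb : 0 < b) (he : Odd e) {n : ℤ}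
    (hn : -((b * e : ℕ) : ℤ) ≤ n) :
    W {b * e} (seedExt (b * e) fun i => squareWave b (-(i + 1 : ℤ)) = 1) n = squareWave b n := by
  have ha : 0 < b * e := Nat.mul_pos hb he.pos
  generalize hN : (n + (b * e : ℕ)).toNat = N
  induction N using Nat.strong_induction_on generalizing n with
  | _ N ih =>
    by_cases h : 0 ≤ n
    · rw [W_singleton_of_nonneg ha _ h, squareWave_sub_odd_mul hb he,
        ih _ (by omega) (by omega) rfl]
    · have hi : -((((-n).toNat - 1 : ℕ) : ℤ) + 1) = n := by omega
      rw [W, if_neg h, seedExt, if_pos (by omega)]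
      simp only [hi, decide_eq_true_eq]
      unfold squareWave
      split_ifs <;> simp_all

theorem le_of_periodicOver_squareWave {b p : ℕ} (hp : 0 < p)
    (h : PeriodicOver (squareWave b) p) : 2 * b ≤ p := by
  by_contra! hlt
  obtain ⟨N, hN⟩ := h
  have key : ∀ r : ℕ, squareWave b r = squareWave b (r + p : ℕ) := by
    intro r
    have hle : (N : ℤ) ≤ r + 2 * b * N := by nlinarith
    have := hN _ hle
    rw [squareWave_add_two_mul, add_right_comm, squareWave_add_two_mul] at this
    exact_mod_cast this
  have hval : ∀ r : ℕ, r < 2 * b → squareWave b r = if r < b then 1 else 0 := by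
    intro r hr
    rw [squareWave, Int.emod_eq_of_lt (by omega) (by omega)]
    simp
  by_cases hpb : p < b
  · have := key (b - 1)
    rw [hval _ (by omega), hval _ (by omega), if_pos (by omega), if_neg (by omega)] at this
    omega
  · have := key 0
    rw [hval _ (by omega), hval _ (by omega), if_pos (by omega), if_neg (by omega)] at this
    omega

theorem periodicOver_congr {w v : ℤ → ℕ} (h : ∀ n, 0 ≤ n → w n = v n) (p : ℕ) :
    PeriodicOver w p ↔ PeriodicOver v p := by
  refine exists_congr fun N => forall_congr' fun n => imp_congr_right fun hn => ?_
  rw [h n (by omega), h (n + p) (by omega)]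

theorem per_squareWave {b : ℕ} (hb : 0 < b) : per (squareWave b) = 2 * b := by
  have h : PeriodicOver (squareWave b) (2 * b) :=
    ⟨0, fun n _ => by simpa using (squareWave_add_two_mul b n 1).symm⟩
  obtain ⟨hpos, hper⟩ := per_pos_and_periodicOver (by omega) h
  exact le_antisymm (Nat.sInf_le ⟨by omega, h⟩) (le_of_periodicOver_squareWave hpos hper)

theorem per_congr {w v : ℤ → ℕ} (h : ∀ n, 0 ≤ n → w n = v n) : per w = per v := by
  simp only [per, periodicOver_congr h]

/-- for `a = 2^k·c` with `c` odd, the set of attainable periods of the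
`{a}`-subtraction game over all seeds is `{2^(k+1)·d : d ∣ c}`. -/
theorem stmt_10 (k c : ℕ) (hc : Odd c) (a : ℕ) (ha : a = 2 ^ k * c) :
    {p : ℕ | ∃ S : ℕ → Bool, per (W {a} (seedExt a S)) = p}
      = {q : ℕ | ∃ d : ℕ, 0 < d ∧ d ∣ c ∧ q = 2 ^ (k + 1) * d} := by
  have ha0 : 0 < a := ha ▸ Nat.mul_pos (by positivity) hc.pos
  ext p
  constructor
  · rintro ⟨S, rfl⟩
    have h2 := periodicOver_two_mul ha0 S
    have hdvd := per_dvd (by omega) h2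
    have hndvd : ¬ per (W {a} (seedExt a S)) ∣ a := by
      intro hda
      have := (per_pos_and_periodicOver (by omega) h2).2.mul_right
        (a / per (W {a} (seedExt a S)))
      rw [Nat.mul_div_cancel' hda] at this
      exact not_periodicOver_self ha0 S this
    rw [show 2 * a = 2 ^ (k + 1) * c by rw [ha]; ring] at hdvd
    obtain ⟨d, hd, hp⟩ := exists_eq_two_pow_mul_of_dvd hdvd (ha ▸ hndvd)
    exact ⟨d, Nat.pos_of_dvd_of_pos hd hc.pos, hd, hp⟩
  · rintro ⟨d, hd, ⟨e, rfl⟩, rfl⟩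
    have hb : 0 < 2 ^ k * d := by positivity
    have hae : a = 2 ^ k * d * e := by rw [ha, mul_assoc]
    subst hae
    refine ⟨_, (per_congr fun n hn => W_eq_squareWave hb (Nat.odd_mul.1 hc).2 (by omega)).trans ?_⟩
    rw [per_squareWave hb]
    ring
end
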